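/- Every row of the observability matrix O := col(C, C·A, C·A², …, C·A⁶) ∈ ℝ^{14×7} lies in the span of the transposes of the second and sixth standard basis vectors e₂ᵀ, e₆ᵀ of ℝ⁷; hence rank O ≤ 2. Moreover, if γ ≠ 0, then rank O = 2, so the pair (C, A) is not observable. -/

import Mathlib

open Real

/-- Parameters of the discretized synchronous generator model. -/
structure GenParams where
  Δt : ℝ
  M : ℝ
  Td0 : ℝ
  D : ℝ
  ωs : ℝ
  Vinf : ℝ
  XS : ℝ
  Xd : ℝ
  Xd' : ℝ
  Xe : ℝ
  Efd : ℝ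
  hΔt : 0 < Δt
  hM : 0 < M
  hTd0 : 0 < Td0
  hXS : XS ≠ 0

namespace GenParams

variable (P : GenParams)

noncomputable def αd : ℝ := P.Δt / P.M
noncomputable def αq : ℝ := P.Δt / P.Td0
noncomputable def γ : ℝ := P.Vinf / P.XS
noncomputable def κ : ℝ := (P.Xd + P.Xe) / P.XS
noncomputable def μ : ℝ := (P.Xd - P.Xd') * P.Vinf / P.XS

/-- The discretized generator dynamics `f : ℝ³ × ℝ → ℝ³`. -/
noncomputable def f (x : Fin 3 → ℝ) (u : ℝ) : Fin 3 → ℝ :=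
  ![x 0 + P.Δt * (x 1 - P.ωs),
    x 1 + P.αd * (u - P.D * (x 1 - P.ωs) - P.γ * (x 2 * Real.sin (x 0))),
    x 2 + P.αq * (P.Efd - P.κ * x 2 + P.μ * Real.cos (x 0))]

/-- The Koopman lifting `Φ : ℝ³ → ℝ⁷`. -/
noncomputable def Φ (x : Fin 3 → ℝ) : Fin 7 → ℝ :=
  ![x 0, x 1 - P.ωs, x 2, Real.sin (x 0), Real.cos (x 0),
    x 2 * Real.sin (x 0), x 2 * Real.cos (x 0)]

/-- The Koopman `A` matrix. -/
noncomputable def Amat : Matrix (Fin 7) (Fin 7) ℝ :=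
  !![1, P.Δt, 0, 0, 0, 0, 0;
     0, 1 - P.αd * P.D, 0, 0, 0, -(P.αd * P.γ), 0;
     0, 0, 1 - P.αq * P.κ, 0, P.αq * P.μ, 0, 0;
     0, 0, 0, 1, 0, 0, 0;
     0, 0, 0, 0, 1, 0, 0;
     0, 0, 0, 0, 0, 1 - P.αq * P.κ, 0;
     0, 0, 0, 0, 0, 0, 1 - P.αq * P.κ]

/-- The Koopman `B` matrix (as a vector, since `m = 1`). -/
noncomputable def Bvec : Fin 7 → ℝ := ![0, P.αd, 0, 0, 0, 0, 0]

/-- The Koopman output matrix `C`. -/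
noncomputable def Cmat : Matrix (Fin 2) (Fin 7) ℝ :=
  !![0, 1, 0, 0, 0, 0, 0;
     0, 0, 0, 0, 0, P.γ, 0]

/-- Admissible states of the operating regime. -/
def Admissible (ωmax Eqmax : ℝ) (x : Fin 3 → ℝ) : Prop :=
  |x 1 - P.ωs| ≤ ωmax ∧ 0 ≤ x 2 ∧ x 2 ≤ Eqmax

end GenParams

/-- Euclidean norm of a vector in `ℝⁿ`. -/
noncomputable def enorm {n : ℕ} (v : Fin n → ℝ) : ℝ := Real.sqrt (∑ i, v i ^ 2)

/-- the observability matrix `O = col(C, CA, …, CA⁶)` has all its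
rows in `span {e₂ᵀ, e₆ᵀ}`, hence rank at most 2; if `γ ≠ 0` its rank equals 2,
so `(C, A)` is not observable (the Kalman rank condition `rank O = 7` fails). -/
theorem observability_matrix_rank_two
    (P : GenParams) (O : Matrix (Fin 7 × Fin 2) (Fin 7) ℝ)
    (hO : ∀ (r : Fin 7 × Fin 2) (j : Fin 7),
      O r j = (P.Cmat * P.Amat ^ ((r.1 : ℕ))) r.2 j) :
    (∀ r : Fin 7 × Fin 2, (fun j => O r j) ∈
        Submodule.span ℝ ({Pi.single 1 1, Pi.single 5 1} : Set (Fin 7 → ℝ)))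
    ∧ O.rank ≤ 2
    ∧ (P.γ ≠ 0 → O.rank = 2 ∧ O.rank < 7) := by
  have hz : ∀ (k : ℕ) (i : Fin 2) (j : Fin 7), j ≠ 1 → j ≠ 5 →
      (P.Cmat * P.Amat ^ k) i j = 0 := by
    intro k
    induction k with
    | zero =>
      intro i j h1 h5
      fin_cases i <;> fin_cases j <;> simp_all [GenParams.Cmat]
    | succ k ih =>
      intro i j h1 h5
      rw [pow_succ, ← Matrix.mul_assoc, Matrix.mul_apply]
      apply Finset.sum_eq_zero
      intro l _
      by_cases hl1 : l = 1
      · subst hl1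
        fin_cases j <;> simp_all [GenParams.Amat]
      by_cases hl5 : l = 5
      · subst hl5
        fin_cases j <;> simp_all [GenParams.Amat]
      rw [ih i l hl1 hl5, zero_mul]
  have hrow : ∀ r : Fin 7 × Fin 2, (fun j => O r j) ∈
        Submodule.span ℝ ({Pi.single 1 1, Pi.single 5 1} : Set (Fin 7 → ℝ)) := by
    intro r
    rw [Submodule.mem_span_pair]
    refine ⟨O r 1, O r 5, ?_⟩
    funext j
    by_cases h1 : j = 1
    · subst h1; simp
    by_cases h5 : j = 5
    · subst h5; simp
    simp [h1, h5, hO, hz]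
  have hle : Submodule.span ℝ (Set.range O.row) ≤
      Submodule.span ℝ ({Pi.single 1 1, Pi.single 5 1} : Set (Fin 7 → ℝ)) := by
    rw [Submodule.span_le]
    rintro _ ⟨r, rfl⟩
    exact hrow r
  have hdim : Module.finrank ℝ (Submodule.span ℝ
      ({Pi.single 1 1, Pi.single 5 1} : Set (Fin 7 → ℝ))) = 2 := by
    have hli : LinearIndependent ℝ ![(Pi.single 1 1 : Fin 7 → ℝ), Pi.single 5 1] := by
      rw [LinearIndependent.pair_iff]
      intro s t h
      have a := congrFun h 1
      have b := congrFun h 5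
      simp at a b
      exact ⟨a, b⟩
    have := finrank_span_eq_card hli
    have hr : Set.range ![(Pi.single 1 1 : Fin 7 → ℝ), Pi.single 5 1] =
        {Pi.single 1 1, Pi.single 5 1} := by
      ext v
      simp
      exact or_comm
    rw [hr] at this
    exact this
  have hrk : O.rank ≤ 2 := by
    rw [Matrix.rank_eq_finrank_span_row]
    exact (Submodule.finrank_mono hle).trans hdim.le
  refine ⟨hrow, hrk, fun hγ => ?_⟩
  have hge : 2 ≤ O.rank := by
    rw [Matrix.rank_eq_finrank_span_row]
    refine hdim.ge.trans (Submodule.finrank_mono ?_)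
    rw [Submodule.span_le]
    rintro v (rfl | rfl)
    · apply Submodule.subset_span
      refine ⟨(0, 0), ?_⟩
      funext j
      fin_cases j <;> simp [Matrix.row, hO, GenParams.Cmat]
    · have hm : O.row (0, 1) ∈ Submodule.span ℝ (Set.range O.row) :=
        Submodule.subset_span ⟨(0, 1), rfl⟩
      have he : (Pi.single 5 1 : Fin 7 → ℝ) = P.γ⁻¹ • O.row (0, 1) := by
        funext j
        fin_cases j <;> simp [Matrix.row, hO, GenParams.Cmat, hγ]
      rw [he]
      exact Submodule.smul_mem _ _ hm
  omega
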